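/- There do not exist complex matrices A, B, C (of the same dimensions, say n×m) satisfying simultaneously: trace(C·Cᴴ) = 1/3, A·Cᴴ = 0, Bᴴ·C = 0, B·Bᴴ = C·Cᴴ, and Aᴴ·A = Cᴴ·C (where Mᴴ denotes the conjugate transpose). -/

import Mathlib

open Matrix

theorem no_solution_to_density_constraints (n m : ℕ) :
    ¬ ∃ A B C : Matrix (Fin n) (Fin m) ℂ,
      (C * Cᴴ).trace = 1/3 ∧
      A * Cᴴ = 0 ∧
      Bᴴ * C = 0 ∧
      B * Bᴴ = C * Cᴴ ∧
      Aᴴ * A = Cᴴ * C := by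
  open scoped ComplexOrder in
  rintro ⟨A, B, C, ht, -, hB, hBC, -⟩
  have h1 : C * Cᴴ * C = 0 := by
    rw [← hBC, Matrix.mul_assoc, hB, Matrix.mul_zero]
  have h2 : Cᴴ * C = 0 := by
    apply Matrix.conjTranspose_mul_self_eq_zero.mp
    rw [Matrix.conjTranspose_mul, Matrix.conjTranspose_conjTranspose, Matrix.mul_assoc,
      ← Matrix.mul_assoc C, h1, Matrix.mul_zero]
  have h3 : C = 0 := Matrix.conjTranspose_mul_self_eq_zero.mp h2
  rw [h3] at ht
  norm_num at ht
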